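/- The braid group B_n is left-orderable: there exists a strict linear order < on B_n such that for all g, h, h' in B_n, h < h' implies g·h < g·h'. -/

import Mathlib

/-- The braid relators in the free group over `Fin (n - 1)`: the index `i` stands for the
Artin generator `σ_{i+1}` (indices are 0-based), and the relators express
`σ_i σ_j σ_i = σ_j σ_i σ_j` for `|i - j| = 1` and `σ_i σ_j = σ_j σ_i` for `|i - j| ≥ 2`. -/
def braidRelsGroup (n : ℕ) : Set (FreeGroup (Fin (n - 1))) :=
  { r | (∃ i j : Fin (n - 1), (i : ℕ) + 1 = (j : ℕ) ∧
          r = .of i * .of j * .of i * (.of j * .of i * .of j)⁻¹) ∨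
        (∃ i j : Fin (n - 1), (i : ℕ) + 2 ≤ (j : ℕ) ∧
          r = .of i * .of j * (.of j * .of i)⁻¹) }

/-- The braid group `B_n`, presented by the generators `σ_1, …, σ_{n-1}` and the
braid relations. -/
def BraidGroup (n : ℕ) := PresentedGroup (braidRelsGroup n)

instance (n : ℕ) : Group (BraidGroup n) :=
  inferInstanceAs (Group (PresentedGroup (braidRelsGroup n)))

/-- The generator `σ_{i+1}` of the braid group `B_n` (0-based index `i : Fin (n - 1)`). -/
def σG {n : ℕ} (i : Fin (n - 1)) : BraidGroup n := PresentedGroup.of i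

/-! ### Reduced syllable words -/

namespace SyllableWord

/-- A word of syllables `(j, k)`, standing for `x_j ^ k`, is reduced after the letter `c` if its
exponents are nonzero, adjacent letters are distinct, and its first letter is not `c`. -/
def Reduced : ℤ → List (ℕ × ℤ) → Prop
  | _, [] => True
  | c, (j, k) :: w => (j : ℤ) ≠ c ∧ k ≠ 0 ∧ Reduced j w

/-- The element of the free group represented by a syllable word. -/
def eval : List (ℕ × ℤ) → FreeGroup ℕ
  | [] => 1
  | (j, k) :: w => FreeGroup.of j ^ k * eval w

/-- Strict order of exponents: `1, 2, 3, …, -3, -2, -1`. -/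
def ExpLT (k l : ℤ) : Prop := (0 < k ∧ l ≤ 0) ∨ (k < l ∧ (0 < k ↔ 0 < l))

/-- The planar order of reduced words after the letter `c`: the possible continuations are
ordered as `c + 1, c + 2, …`, then the end of the word, then `0, 1, …, c - 1`. -/
def PlanarLT : ℤ → List (ℕ × ℤ) → List (ℕ × ℤ) → Prop
  | _, [], [] => False
  | c, [], (j, _) :: _ => (j : ℤ) ≤ c
  | c, (j, _) :: _, [] => c < j
  | c, (j, k) :: u, (j', k') :: v =>
    (c < j ∧ (j' : ℤ) ≤ c) ∨ (j < j' ∧ (c < j ↔ c < j')) ∨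
      (j = j' ∧ (ExpLT k k' ∨ (k = k' ∧ PlanarLT j u v)))

/-- A code of syllable words whose lexicographic order is the planar order. -/
def code : ℤ → List (ℕ × ℤ) → List (ℤ ×ₗ ℤ)
  | _, [] => [toLex (1, 0)]
  | c, (j, k) :: w =>
    toLex (if c < j then 0 else 2, (j : ℤ)) :: toLex (if 0 < k then 0 else 1, k) :: code j w

theorem code_lt_code_iff (c : ℤ) (u v : List (ℕ × ℤ)) :
    code c u < code c v ↔ PlanarLT c u v := by
  induction u generalizing c v with
  | nil =>
    rcases v with _ | ⟨⟨j, k⟩, v⟩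
    · simp [code, PlanarLT]
    · simp only [code, PlanarLT, List.cons_lt_cons_iff, Prod.Lex.toLex_lt_toLex, toLex_inj,
        Prod.mk.injEq]
      split_ifs <;> simp <;> omega
  | cons p u ih =>
    obtain ⟨j, k⟩ := p
    rcases v with _ | ⟨⟨j', k'⟩, v⟩
    · simp only [code, PlanarLT, List.cons_lt_cons_iff, Prod.Lex.toLex_lt_toLex, toLex_inj,
        Prod.mk.injEq]
      split_ifs <;> simp <;> omega
    · simp only [code, PlanarLT, ExpLT, List.cons_lt_cons_iff, Prod.Lex.toLex_lt_toLex, toLex_inj,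
        Prod.mk.injEq]
      by_cases hj : j = j'
      · subst hj
        rw [ih]
        by_cases hk : k = k'
        · subst hk; simp; grind
        · split_ifs <;> simp [hk] <;> grind
      · have : (j : ℤ) ≠ j' := by exact_mod_cast hj
        split_ifs <;> simp [hj] <;> omega

theorem code_injective (c : ℤ) : Function.Injective (code c) := by
  intro u
  induction u generalizing c with
  | nil =>
    rintro (_ | ⟨⟨j, k⟩, v⟩) h
    · rfl
    · simp only [code, List.cons.injEq, toLex_inj, Prod.mk.injEq] at h
      split_ifs at h <;> simp at h
  | cons p u ih =>
    obtain ⟨j, k⟩ := p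
    rintro (_ | ⟨⟨j', k'⟩, v⟩) h
    · simp only [code, List.cons.injEq, toLex_inj, Prod.mk.injEq] at h
      split_ifs at h <;> simp at h
    · simp only [code, List.cons.injEq, toLex_inj, Prod.mk.injEq, Nat.cast_inj] at h
      obtain ⟨⟨-, rfl⟩, ⟨-, rfl⟩, h⟩ := h
      rw [ih _ h]

theorem Reduced.isChain {c : ℤ} {w : List (ℕ × ℤ)} (h : Reduced c w) :
    (w.map fun p : ℕ × ℤ => (⟨p.1, Multiplicative.ofAdd p.2⟩ : Σ _ : ℕ, Multiplicative ℤ)).IsChain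
      (fun l l' => l.1 ≠ l'.1) := by
  induction w generalizing c with
  | nil => simp
  | cons p w ih =>
    obtain ⟨j, k⟩ := p
    rcases w with _ | ⟨⟨j', k'⟩, w⟩
    · simp
    · have h' := ih h.2.2
      simp only [List.map_cons, List.isChain_cons_cons] at h' ⊢
      refine ⟨fun e => h.2.2.1 (by exact_mod_cast e.symm), h'⟩

theorem Reduced.exp_ne_zero {c : ℤ} {w : List (ℕ × ℤ)} (h : Reduced c w) :
    ∀ p ∈ w, p.2 ≠ 0 := by
  induction w generalizing c with
  | nil => simp
  | cons p w ih =>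
    simp only [List.mem_cons, forall_eq_or_imp]
    exact ⟨h.2.1, ih h.2.2⟩

/-- A reduced syllable word, as a reduced word in the free product of copies of `ℤ`. -/
def Reduced.toWord {c : ℤ} {w : List (ℕ × ℤ)} (h : Reduced c w) :
    Monoid.CoprodI.Word (fun _ : ℕ => Multiplicative ℤ) where
  toList := w.map fun p => ⟨p.1, Multiplicative.ofAdd p.2⟩
  ne_one := by
    simp only [List.mem_map, forall_exists_index, and_imp]
    rintro _ p hp rfl
    simpa using h.exp_ne_zero p hp
  chain_ne := h.isChain

theorem Reduced.prod_toWord {c : ℤ} {w : List (ℕ × ℤ)} (h : Reduced c w) :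
    h.toWord.prod = FreeGroup.lift (fun j => (Monoid.CoprodI.of (i := j) (Multiplicative.ofAdd 1) :
      Monoid.CoprodI (fun _ : ℕ => Multiplicative ℤ))) (eval w) := by
  simp only [Monoid.CoprodI.Word.prod, Reduced.toWord, List.map_map]
  clear h
  induction w with
  | nil => simp [eval]
  | cons p w ih =>
    simp only [List.map_cons, List.prod_cons, ih, eval, map_mul, map_zpow, FreeGroup.lift_apply_of,
      Function.comp]
    rw [← map_zpow, ← ofAdd_zsmul]
    simp

theorem Reduced.eq_of_eval_eq {c d : ℤ} {u v : List (ℕ × ℤ)} (hu : Reduced c u) (hv : Reduced d v)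
    (h : eval u = eval v) : u = v := by
  have h1 : hu.toWord = hv.toWord :=
    Monoid.CoprodI.Word.equiv.symm.injective (by
      change hu.toWord.prod = hv.toWord.prod
      rw [hu.prod_toWord, hv.prod_toWord, h])
  have h2 := congrArg Monoid.CoprodI.Word.toList h1
  refine List.map_injective_iff.2 ?_ h2
  rintro ⟨a, b⟩ ⟨a', b'⟩ e
  simpa using e

/-- Prepend `x_j ^ k`, where `k` is allowed to vanish. -/
def push (j : ℕ) (k : ℤ) (w : List (ℕ × ℤ)) : List (ℕ × ℤ) := if k = 0 then w else (j, k) :: w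

theorem eval_push (j : ℕ) (k : ℤ) (w : List (ℕ × ℤ)) :
    eval (push j k w) = FreeGroup.of j ^ k * eval w := by
  by_cases hk : k = 0 <;> simp [push, hk, eval]

theorem Reduced.mono {c d : ℤ} {w : List (ℕ × ℤ)} (h : Reduced c w)
    (hd : ∀ p ∈ w.head?, (p.1 : ℤ) ≠ d) : Reduced d w := by
  rcases w with _ | ⟨⟨j, k⟩, w⟩
  · trivial
  · exact ⟨hd _ rfl, h.2⟩

theorem exists_reduced_zpow_mul (j : ℕ) (k : ℤ) {w : List (ℕ × ℤ)} (h : Reduced (-1) w) :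
    ∃ w', Reduced (-1) w' ∧ eval w' = FreeGroup.of j ^ k * eval w := by
  rcases eq_or_ne k 0 with rfl | hk
  · exact ⟨w, h, by simp⟩
  rcases w with _ | ⟨⟨j', k'⟩, w⟩
  · exact ⟨[(j, k)], ⟨by omega, hk, trivial⟩, rfl⟩
  by_cases hj : j' = j
  · subst hj
    obtain ⟨h1, h2, h3⟩ := h
    refine ⟨push j' (k + k') w, ?_, by rw [eval_push, eval, zpow_add, mul_assoc]⟩
    rw [push]
    split_ifs with h0
    · exact h3.mono fun p _ => by omega
    · exact ⟨h1, h0, h3⟩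
  · exact ⟨(j, k) :: (j', k') :: w, ⟨by omega, hk, by exact_mod_cast hj, h.2⟩, rfl⟩

theorem exists_reduced_eval_eq (g : FreeGroup ℕ) : ∃ w, Reduced (-1) w ∧ eval w = g := by
  have key : ∀ g : FreeGroup ℕ, ∀ w, Reduced (-1) w →
      ∃ w', Reduced (-1) w' ∧ eval w' = g * eval w := by
    intro g
    induction g using FreeGroup.induction_on with
    | C1 => exact fun w hw => ⟨w, hw, by simp⟩
    | of j => exact fun w hw => by simpa using exists_reduced_zpow_mul j 1 hw
    | inv_of j _ => exact fun w hw => by simpa using exists_reduced_zpow_mul j (-1) hw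
    | mul x y hx hy =>
      intro w hw
      obtain ⟨w', hw', e⟩ := hy w hw
      obtain ⟨w'', hw'', e'⟩ := hx w' hw'
      exact ⟨w'', hw'', by rw [e', e, mul_assoc]⟩
  obtain ⟨w, hw, e⟩ := key g [] trivial
  exact ⟨w, hw, by simpa [eval] using e⟩

/-- The reduced syllable word representing an element of the free group. -/
noncomputable def normalForm (g : FreeGroup ℕ) : List (ℕ × ℤ) := (exists_reduced_eval_eq g).choose

theorem reduced_normalForm (g : FreeGroup ℕ) : Reduced (-1) (normalForm g) :=
  (exists_reduced_eval_eq g).choose_spec.1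

theorem eval_normalForm (g : FreeGroup ℕ) : eval (normalForm g) = g :=
  (exists_reduced_eval_eq g).choose_spec.2

theorem normalForm_injective : Function.Injective normalForm :=
  Function.LeftInverse.injective eval_normalForm

end SyllableWord

/-! ### The Artin automorphisms preserve the planar order -/

/-- The endomorphism `x_i ↦ x_i x_{i+1} x_i⁻¹`, `x_{i+1} ↦ x_i` of the free group. -/
def artinHom (i : ℕ) : FreeGroup ℕ →* FreeGroup ℕ :=
  FreeGroup.lift fun j =>
    if j = i then FreeGroup.of i * FreeGroup.of (i + 1) * (FreeGroup.of i)⁻¹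
    else if j = i + 1 then FreeGroup.of i else FreeGroup.of j

/-- The endomorphism `x_i ↦ x_{i+1}`, `x_{i+1} ↦ x_{i+1}⁻¹ x_i x_{i+1}` of the free group. -/
def artinInvHom (i : ℕ) : FreeGroup ℕ →* FreeGroup ℕ :=
  FreeGroup.lift fun j =>
    if j = i then FreeGroup.of (i + 1)
    else if j = i + 1 then (FreeGroup.of (i + 1))⁻¹ * FreeGroup.of i * FreeGroup.of (i + 1)
    else FreeGroup.of j

/-- The Artin automorphism `x_i ↦ x_i x_{i+1} x_i⁻¹`, `x_{i+1} ↦ x_i` of the free group. -/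
def artinAut (i : ℕ) : MulAut (FreeGroup ℕ) :=
  MonoidHom.toMulEquiv (artinHom i) (artinInvHom i)
    (FreeGroup.ext_hom _ _ fun j => by
      simp only [MonoidHom.comp_apply, MonoidHom.id_apply, artinHom, artinInvHom,
        FreeGroup.lift_apply_of]
      split_ifs with h1 h2 <;> simp [*, mul_assoc])
    (FreeGroup.ext_hom _ _ fun j => by
      simp only [MonoidHom.comp_apply, MonoidHom.id_apply, artinHom, artinInvHom,
        FreeGroup.lift_apply_of]
      split_ifs with h1 h2 <;> simp [*, mul_assoc])

theorem artinAut_of (i j : ℕ) : artinAut i (FreeGroup.of j) =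
    if j = i then FreeGroup.of i * FreeGroup.of (i + 1) * (FreeGroup.of i)⁻¹
    else if j = i + 1 then FreeGroup.of i else FreeGroup.of j :=
  FreeGroup.lift_apply_of

theorem artinAut_inv_of (i j : ℕ) : (artinAut i)⁻¹ (FreeGroup.of j) =
    if j = i then FreeGroup.of (i + 1)
    else if j = i + 1 then (FreeGroup.of (i + 1))⁻¹ * FreeGroup.of i * FreeGroup.of (i + 1)
    else FreeGroup.of j :=
  FreeGroup.lift_apply_of

theorem artinAut_of_self (i : ℕ) : artinAut i (FreeGroup.of i) =
    FreeGroup.of i * FreeGroup.of (i + 1) * (FreeGroup.of i)⁻¹ := by simp [artinAut_of]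

theorem artinAut_of_succ (i : ℕ) : artinAut i (FreeGroup.of (i + 1)) = FreeGroup.of i := by
  simp [artinAut_of]

theorem artinAut_of_of_ne {i j : ℕ} (h : j ≠ i) (h' : j ≠ i + 1) :
    artinAut i (FreeGroup.of j) = FreeGroup.of j := by
  simp [artinAut_of, h, h']

namespace SyllableWord

mutual

/-- The action of the Artin automorphism on reduced words. -/
def artinWord (i : ℕ) : List (ℕ × ℤ) → List (ℕ × ℤ)
  | [] => []
  | (j, k) :: w =>
    if j = i then (i, 1) :: (i + 1, k) :: artinAfterFst i w
    else if j = i + 1 then artinAfterSnd i (k + 1) w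
    else (j, k) :: artinWord i w

/-- The word of `x_i⁻¹ * artinAut i w`, for words `w` reduced after `x_i`. -/
def artinAfterFst (i : ℕ) : List (ℕ × ℤ) → List (ℕ × ℤ)
  | [] => [(i, -1)]
  | (j, k) :: w =>
    if j = i + 1 then artinAfterSnd i k w
    else if j = i then (i + 1, k) :: artinAfterFst i w
    else (i, -1) :: (j, k) :: artinWord i w

/-- The word of `x_i ^ (m - 1) * artinAut i w`, for words `w` reduced after `x_{i+1}`. -/
def artinAfterSnd (i : ℕ) (m : ℤ) : List (ℕ × ℤ) → List (ℕ × ℤ)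
  | [] => push i (m - 1) []
  | (j, k) :: w =>
    if j = i then push i m ((i + 1, k) :: artinAfterFst i w)
    else if j = i + 1 then artinAfterSnd i (m + k) w
    else push i (m - 1) ((j, k) :: artinWord i w)

end

theorem eval_artin (i : ℕ) (w : List (ℕ × ℤ)) :
    eval (artinWord i w) = artinAut i (eval w) ∧
      eval (artinAfterFst i w) = (FreeGroup.of i)⁻¹ * artinAut i (eval w) ∧
      ∀ m, eval (artinAfterSnd i m w) = FreeGroup.of i ^ (m - 1) * artinAut i (eval w) := by
  induction w with
  | nil => simp [artinWord, artinAfterFst, artinAfterSnd, eval, eval_push]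
  | cons p w ih =>
    obtain ⟨j, k⟩ := p
    obtain ⟨h1, h2, h3⟩ := ih
    rcases eq_or_ne j i with rfl | hi
    · have e : artinAut j (FreeGroup.of j ^ k) =
          FreeGroup.of j * FreeGroup.of (j + 1) ^ k * (FreeGroup.of j)⁻¹ := by
        rw [map_zpow, artinAut_of_self, conj_zpow]
      refine ⟨?_, ?_, fun m => ?_⟩
      · simp [artinWord, eval, h2, e, mul_assoc]
      · simp [artinAfterFst, eval, h2, e, mul_assoc]
      · simp only [artinAfterSnd, eval, eval_push, h2, e, map_mul, if_true, zpow_sub_one]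
        group
    rcases eq_or_ne j (i + 1) with rfl | hi'
    · refine ⟨?_, ?_, fun m => ?_⟩
      · simp [artinWord, eval, h3, artinAut_of_succ]
      · simp only [artinAfterFst, eval, h3, artinAut_of_succ, if_true, map_mul, map_zpow]
        group
      · simp only [artinAfterSnd, eval, h3, artinAut_of_succ, if_true, map_mul, map_zpow, if_neg hi]
        group
    · have e := artinAut_of_of_ne hi hi'
      refine ⟨?_, ?_, fun m => ?_⟩
      · simp [artinWord, eval, h1, hi, hi', e]
      · simp [artinAfterFst, eval, h1, hi, hi', e]
      · simp [artinAfterSnd, eval, eval_push, h1, hi, hi', e]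

theorem eval_artinWord (i : ℕ) (w : List (ℕ × ℤ)) :
    eval (artinWord i w) = artinAut i (eval w) := (eval_artin i w).1

theorem reduced_artin (i : ℕ) (w : List (ℕ × ℤ)) :
    (∀ c : ℤ, c ≠ i → c ≠ i + 1 → Reduced c w → Reduced c (artinWord i w)) ∧
      (Reduced i w → Reduced (i + 1) (artinAfterFst i w)) ∧
      ∀ (c m : ℤ), c ≠ i → (c = i + 1 → m ≠ 0) → (c ≠ i + 1 → m ≠ 1) → Reduced (i + 1) w →
        Reduced c (artinAfterSnd i m w) := by
  induction w with
  | nil =>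
    simp only [artinWord, artinAfterFst, artinAfterSnd, Reduced, push]
    refine ⟨by simp, by simp, fun c m h1 h2 h3 _ => ?_⟩
    split_ifs
    · trivial
    · exact ⟨by omega, by omega, trivial⟩
  | cons p w ih =>
    obtain ⟨j, k⟩ := p
    obtain ⟨h1, h2, h3⟩ := ih
    have h1' := h1 j
    simp only [artinWord, artinAfterFst, artinAfterSnd, push]
    refine ⟨?_, ?_, ?_⟩
    · intro c hc hc' h
      simp only [Reduced] at h
      split_ifs <;> grind [Reduced]
    · intro h
      simp only [Reduced] at h
      split_ifs <;> grind [Reduced]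
    · intro c m hc hc' hm h
      simp only [Reduced] at h
      split_ifs <;> grind [Reduced]

theorem planarLT_artinAfterSnd_of_expLT (i : ℕ) (u v : List (ℕ × ℤ)) (hu : Reduced (i + 1) u)
    (hv : Reduced (i + 1) v) (c k l : ℤ) (hk : k ≠ 0) (hl : l ≠ 0) (hkl : ExpLT k l)
    (hc : c ≠ i) :
    (c = i + 1 → PlanarLT c (artinAfterSnd i k u) (artinAfterSnd i l v)) ∧
    (c ≠ i + 1 → PlanarLT c (artinAfterSnd i (k + 1) u) (artinAfterSnd i (l + 1) v)) := by
  rcases u with _ | ⟨⟨j, p⟩, u⟩ <;> rcases v with _ | ⟨⟨j', q⟩, v⟩ <;>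
  simp only [artinAfterSnd, push, Reduced, ExpLT] at * <;>
  refine ⟨fun h => ?_, fun h => ?_⟩ <;>
  split_ifs <;> grind [PlanarLT, ExpLT]

theorem planarLT_artin (i : ℕ) (u : List (ℕ × ℤ)) :
    (∀ (c : ℤ) (v), c ≠ i → c ≠ i + 1 → Reduced c u → Reduced c v → PlanarLT c u v →
      PlanarLT c (artinWord i u) (artinWord i v)) ∧
    (∀ v, Reduced i u → Reduced i v → PlanarLT i u v →
      PlanarLT (i + 1) (artinAfterFst i u) (artinAfterFst i v)) ∧
    ∀ (c m : ℤ) (v), c ≠ i → (c = i + 1 → m ≠ 0) → (c ≠ i + 1 → m ≠ 1) → Reduced (i + 1) u →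
      Reduced (i + 1) v → PlanarLT (i + 1) u v →
      PlanarLT c (artinAfterSnd i m u) (artinAfterSnd i m v) := by
  induction u with
  | nil =>
    refine ⟨?_, ?_, ?_⟩
    · rintro c (_ | ⟨⟨j, k⟩, v⟩) hc hc' hu hv h
      · exact h.elim
      · simp only [artinWord]
        rcases v with _ | ⟨⟨j', k'⟩, v⟩ <;>
        simp only [artinAfterSnd, push] <;> split_ifs <;> grind [PlanarLT, Reduced, ExpLT]
    · rintro (_ | ⟨⟨j, k⟩, v⟩) hu hv h
      · exact h.elim
      · simp only [artinAfterFst]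
        rcases v with _ | ⟨⟨j', k'⟩, v⟩ <;>
        simp only [artinAfterSnd, push] <;> split_ifs <;> grind [PlanarLT, Reduced, ExpLT]
    · rintro c m (_ | ⟨⟨j, k⟩, v⟩) hc hm hm' hu hv h
      · exact h.elim
      · simp only [artinAfterSnd, push]
        split_ifs <;> grind [PlanarLT, Reduced, ExpLT]
  | cons p u ih =>
    obtain ⟨j, k⟩ := p
    obtain ⟨h1, h2, h3⟩ := ih
    refine ⟨?_, ?_, ?_⟩
    · rintro c (_ | ⟨⟨j', k'⟩, v⟩) hc hc' hu hv h
      · simp only [artinWord]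
        rcases u with _ | ⟨⟨j', k'⟩, u⟩ <;>
        simp only [artinAfterSnd, push] <;> split_ifs <;> grind [PlanarLT, Reduced, ExpLT]
      · have e1 := h1 j v
        have e2 := h2 v
        have e3 := h3 c (k + 1) v hc
        have e4 := planarLT_artinAfterSnd_of_expLT i u v
        simp only [artinWord]
        by_cases hj : j = i + 1
        · subst hj
          by_cases hj' : j' = i + 1
          · subst hj'
            grind [PlanarLT, Reduced, ExpLT]
          · rcases u with _ | ⟨⟨p, q⟩, u⟩ <;>
            simp only [artinAfterSnd, push] <;> split_ifs <;> grind [PlanarLT, Reduced, ExpLT]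
        · by_cases hj' : j' = i + 1
          · rcases v with _ | ⟨⟨p, q⟩, v⟩ <;>
            simp only [artinAfterSnd, push] <;> split_ifs <;> grind [PlanarLT, Reduced, ExpLT]
          · grind [PlanarLT, Reduced, ExpLT]
    · rintro (_ | ⟨⟨j', k'⟩, v⟩) hu hv h
      · simp only [artinAfterFst]
        rcases u with _ | ⟨⟨j', k'⟩, u⟩ <;>
        simp only [artinAfterSnd, push] <;> split_ifs <;> grind [PlanarLT, Reduced, ExpLT]
      · have e1 := h1 j v
        have e2 := h2 v
        have e3 := h3 (i + 1) k v (by omega)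
        have e4 := planarLT_artinAfterSnd_of_expLT i u v
        simp only [artinAfterFst]
        by_cases hj : j = i + 1
        · subst hj
          by_cases hj' : j' = i + 1
          · subst hj'
            grind [PlanarLT, Reduced, ExpLT]
          · rcases u with _ | ⟨⟨p, q⟩, u⟩ <;>
            simp only [artinAfterSnd, push] <;> split_ifs <;> grind [PlanarLT, Reduced, ExpLT]
        · by_cases hj' : j' = i + 1
          · rcases v with _ | ⟨⟨p, q⟩, v⟩ <;>
            simp only [artinAfterSnd, push] <;> split_ifs <;> grind [PlanarLT, Reduced, ExpLT]
          · grind [PlanarLT, Reduced, ExpLT]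
    · rintro c m (_ | ⟨⟨j', k'⟩, v⟩) hc hm hm' hu hv h
      · simp only [artinAfterSnd, push]
        split_ifs <;> grind [PlanarLT, Reduced, ExpLT]
      · simp only [artinAfterSnd, push]
        simp only [Reduced, PlanarLT] at hu hv h
        have := h1 j v
        have := h2 v
        split_ifs <;> grind [PlanarLT, ExpLT]

end SyllableWord
open SyllableWord in
/-- An encoding of the elements of the free group in a linear order. -/
noncomputable def planarCode (g : FreeGroup ℕ) : List (ℤ ×ₗ ℤ) := code (-1) (normalForm g)

open SyllableWord in
theorem planarCode_injective : Function.Injective planarCode :=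
  (code_injective _).comp normalForm_injective

open SyllableWord in
theorem planarCode_artinAut_lt (i : ℕ) {g h : FreeGroup ℕ} (hgh : planarCode g < planarCode h) :
    planarCode (artinAut i g) < planarCode (artinAut i h) := by
  have e (g : FreeGroup ℕ) : normalForm (artinAut i g) = artinWord i (normalForm g) :=
    (reduced_normalForm _).eq_of_eval_eq
      ((reduced_artin i _).1 (-1) (by omega) (by omega) (reduced_normalForm g))
      (by rw [eval_artinWord, eval_normalForm, eval_normalForm])
  simp only [planarCode, e, code_lt_code_iff] at hgh ⊢
  exact (planarLT_artin i _).1 (-1) _ (by omega) (by omega) (reduced_normalForm g)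
    (reduced_normalForm h) hgh

/-- The group of automorphisms of the free group preserving the planar order. -/
def planarAut : Subgroup (MulAut (FreeGroup ℕ)) where
  carrier := {f | ∀ g h, planarCode (f g) < planarCode (f h) ↔ planarCode g < planarCode h}
  one_mem' _ _ := Iff.rfl
  mul_mem' ha hb g h := (ha _ _).trans (hb g h)
  inv_mem' {f} hf g h := by
    rw [← hf, MulAut.apply_inv_self, MulAut.apply_inv_self]

theorem artinAut_mem_planarAut (i : ℕ) : artinAut i ∈ planarAut := by
  refine fun g h => ⟨fun hlt => ?_, planarCode_artinAut_lt i⟩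
  rcases lt_trichotomy (planarCode g) (planarCode h) with h1 | h1 | h1
  · exact h1
  · rw [planarCode_injective h1] at hlt
    exact absurd hlt (lt_irrefl _)
  · exact absurd (hlt.trans (planarCode_artinAut_lt i h1)) (lt_irrefl _)

/-! ### Consequences of the braid relation -/

section

variable {G : Type*} [Group G] {p q : G}

theorem mul_inv_mul_inv_of_braid (h : p * q * p = q * p * q) :
    p * q⁻¹ * p⁻¹ = q⁻¹ * p⁻¹ * q :=
  calc p * q⁻¹ * p⁻¹ = q⁻¹ * p⁻¹ * (p * q * p) * (q⁻¹ * p⁻¹) := by group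
    _ = q⁻¹ * p⁻¹ * q := by rw [h]; group

theorem conj_conj_sq_of_braid (h : p * q * p = q * p * q) :
    q * (p * q ^ 2 * p⁻¹) * q⁻¹ = p ^ 2 := by
  simp only [pow_two]
  calc q * (p * (q * q) * p⁻¹) * q⁻¹ = (q * p * q) * q * p⁻¹ * q⁻¹ := by group
    _ = p * q * p * q * p⁻¹ * q⁻¹ := by rw [← h]
    _ = p * (q * p * q) * p⁻¹ * q⁻¹ := by group
    _ = p * p := by rw [← h]; group

theorem commute_mul_sq_mul_of_braid (h : p * q * p = q * p * q) :
    Commute q (p * q ^ 2 * p) := by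
  simp only [pow_two]
  calc q * (p * (q * q) * p) = (q * p * q) * q * p := by group
    _ = p * q * p * q * p := by rw [← h]
    _ = p * q * (p * q * p) := by group
    _ = p * (q * q) * p * q := by rw [h]; group

end

/-! ### Coset decomposition in groups generated by braids -/

/-- The first `N` terms of a sequence satisfy the braid relations. -/
structure IsBraidFamily {G : Type*} [Group G] (N : ℕ) (s : ℕ → G) : Prop where
  braid : ∀ i, i + 1 < N → s i * s (i + 1) * s i = s (i + 1) * s i * s (i + 1)
  comm : ∀ i j, i + 2 ≤ j → j < N → Commute (s i) (s j)

namespace IsBraidFamily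

variable {G : Type*} [Group G] {N : ℕ} {s : ℕ → G}

/-- The subgroup generated by the terms of index at least `k`. -/
def tail (N : ℕ) (s : ℕ → G) (k : ℕ) : Subgroup G := Subgroup.closure (s '' {i | k ≤ i ∧ i < N})

/-- The braid `s_{k+d-1}⁻¹ ⋯ s_k⁻¹`, moving the strand `k` to the position `k + d`. -/
def transport (s : ℕ → G) (k : ℕ) : ℕ → G
  | 0 => 1
  | d + 1 => (s (k + d))⁻¹ * transport s k d

/-- The pure braid in which the strand `k` goes around the strand `k + d + 1`. -/
def loop (s : ℕ → G) (k d : ℕ) : G := (transport s k d)⁻¹ * s (k + d) ^ 2 * transport s k d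

/-- The homomorphism from a free group whose range is generated by the loops of the strand `k`. -/
def loopHom (N : ℕ) (s : ℕ → G) (k : ℕ) : FreeGroup {d : ℕ // k + d < N} →* G :=
  FreeGroup.lift fun d => (loop s k d)⁻¹

theorem mem_tail {k i : ℕ} (h : k ≤ i) (h' : i < N) : s i ∈ tail N s k :=
  Subgroup.subset_closure ⟨i, ⟨h, h'⟩, rfl⟩

theorem loop_mem_range {k d : ℕ} (h : k + d < N) : loop s k d ∈ (loopHom N s k).range :=
  ⟨(FreeGroup.of ⟨d, h⟩)⁻¹, by simp [loopHom]⟩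

theorem commute_transport (hs : IsBraidFamily N s) {k d i : ℕ} (h : k + d < i) (hi : i < N) :
    Commute (s i) (transport s k d) := by
  induction d with
  | zero => exact Commute.one_right _
  | succ d ih =>
    exact ((hs.comm (k + d) i (by omega) hi).symm.inv_right).mul_right (ih (by omega))

theorem mul_transport (hs : IsBraidFamily N s) {k d i : ℕ} (hk : k ≤ i) (hi : i + 1 < k + d)
    (hd : k + d ≤ N) : s i * transport s k d = transport s k d * s (i + 1) := by
  induction d with
  | zero => omega
  | succ d ih =>
    rcases eq_or_ne (i + 1) (k + d) with h | h
    · obtain ⟨e, rfl⟩ : ∃ e, d = e + 1 := ⟨d - 1, by omega⟩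
      obtain rfl : i = k + e := by omega
      have h1 := hs.braid (k + e) (by omega)
      have h2 := (hs.commute_transport (k := k) (d := e) (i := k + e + 1) (by omega)
        (by omega)).eq
      simp only [transport, ← add_assoc]
      set t := transport s k e
      set p := s (k + e)
      set q := s (k + e + 1)
      calc p * (q⁻¹ * (p⁻¹ * t)) = p * q⁻¹ * p⁻¹ * t := by group
        _ = q⁻¹ * p⁻¹ * (q * t) := by rw [mul_inv_mul_inv_of_braid h1]; group
        _ = q⁻¹ * (p⁻¹ * t) * q := by rw [h2]; group
    · rw [transport, ← mul_assoc, ((hs.comm i (k + d) (by omega) (by omega)).inv_right).eq,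
        mul_assoc, ih (by omega) (by omega), mul_assoc]

theorem conj_loop_succ (hs : IsBraidFamily N s) {k e : ℕ} (h : k + e + 1 < N) :
    s (k + e + 1) * loop s k (e + 1) * (s (k + e + 1))⁻¹ = loop s k e := by
  have h1 := hs.braid (k + e) h
  have h2 := (hs.commute_transport (k := k) (d := e) (i := k + e + 1) (by omega) h).inv_right.eq
  have h3 := conj_conj_sq_of_braid h1
  simp only [loop, transport, ← add_assoc]
  set t := transport s k e
  set p := s (k + e)
  set q := s (k + e + 1)
  calc q * ((p⁻¹ * t)⁻¹ * q ^ 2 * (p⁻¹ * t)) * q⁻¹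
      = (q * t⁻¹) * (p * q ^ 2 * p⁻¹) * (q * t⁻¹)⁻¹ := by group
    _ = t⁻¹ * (q * (p * q ^ 2 * p⁻¹) * q⁻¹) * t := by rw [h2]; group
    _ = t⁻¹ * p ^ 2 * t := by rw [h3]

theorem commute_loop_mul_loop (hs : IsBraidFamily N s) {k e : ℕ} (h : k + e + 1 < N) :
    Commute (s (k + e + 1)) (loop s k (e + 1) * loop s k e) := by
  have h1 := hs.braid (k + e) h
  have h2 := (hs.commute_transport (k := k) (d := e) (i := k + e + 1) (by omega) h)
  have h3 := commute_mul_sq_mul_of_braid h1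
  have e1 : loop s k (e + 1) * loop s k e = (transport s k e)⁻¹ *
      (s (k + e) * s (k + e + 1) ^ 2 * s (k + e)) * transport s k e := by
    simp only [loop, transport, ← add_assoc]
    group
  rw [e1]
  exact (h2.inv_right.mul_right h3).mul_right h2

theorem commute_loop (hs : IsBraidFamily N s) {k d i : ℕ} (hk : k < i) (hi : i < N)
    (hd : k + d < N) (h : i < k + d ∨ k + d + 1 < i) : Commute (s i) (loop s k d) := by
  rcases h with h | h
  · obtain ⟨i, rfl⟩ : ∃ j, i = j + 1 := ⟨i - 1, by omega⟩
    have h1 := hs.mul_transport (k := k) (d := d) (i := i) (by omega) (by omega) (by omega)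
    have h2 := (hs.comm i (k + d) (by omega) hd).pow_right 2
    have e1 : s (i + 1) = (transport s k d)⁻¹ * s i * transport s k d := by
      rw [mul_assoc, h1, inv_mul_cancel_left]
    rw [e1]
    simpa [loop] using (Commute.conj_iff (transport s k d)⁻¹).2 h2
  · have h1 := hs.commute_transport (k := k) (d := d) (i := i) (by omega) hi
    have h2 := (hs.comm (k + d) i (by omega) hi).symm.pow_right 2
    exact (h1.inv_right.mul_right h2).mul_right h1

theorem tail_le_normalizer (hs : IsBraidFamily N s) (k : ℕ) :
    tail N s (k + 1) ≤ Subgroup.normalizer (loopHom N s k).range := by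
  rw [tail, Subgroup.closure_le]
  rintro _ ⟨i, ⟨hk, hi⟩, rfl⟩
  set A := (loopHom N s k).range
  have key : ∀ d, k + d < N → s i * loop s k d * (s i)⁻¹ ∈ A ∧ (s i)⁻¹ * loop s k d * s i ∈ A := by
    intro d hd
    have hA := loop_mem_range (s := s) hd
    by_cases h : i < k + d ∨ k + d + 1 < i
    · have h1 := hs.commute_loop (by omega) hi hd h
      rw [h1.eq, mul_inv_cancel_right, mul_assoc, ← h1.eq, inv_mul_cancel_left]
      exact ⟨hA, hA⟩
    obtain ⟨e, rfl⟩ : ∃ e, i = k + e + 1 := ⟨i - k - 1, by omega⟩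
    have h0 : loop s k e ∈ A := loop_mem_range (by omega)
    have h1 : loop s k (e + 1) ∈ A := loop_mem_range hi
    have e1 := hs.conj_loop_succ hi
    have e2 := (hs.commute_loop_mul_loop hi).eq
    set q := s (k + e + 1)
    set a := loop s k e
    set b := loop s k (e + 1)
    have e3 : q * b * q⁻¹ = a := e1
    have e4 : q * a * q⁻¹ = a⁻¹ * b * a :=
      calc q * a * q⁻¹ = (q * b * q⁻¹)⁻¹ * (q * (b * a)) * q⁻¹ := by group
        _ = a⁻¹ * b * a := by rw [e2, e3]; group
    have e5 : q⁻¹ * a * q = b := by rw [← e3]; group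
    have e6 : q⁻¹ * b * q = b * a * b⁻¹ :=
      calc q⁻¹ * b * q = q⁻¹ * (b * a * q) * (q⁻¹ * a * q)⁻¹ := by group
        _ = b * a * b⁻¹ := by rw [← e2, e5]; group
    obtain rfl | rfl : d = e + 1 ∨ d = e := by omega
    · exact ⟨e3 ▸ h0, e6 ▸ A.mul_mem (A.mul_mem h1 h0) (A.inv_mem h1)⟩
    · exact ⟨e4 ▸ A.mul_mem (A.mul_mem (A.inv_mem h0) h1) h0, e5 ▸ h1⟩
  have conj : ∀ g : G, (∀ d, k + d < N → g * loop s k d * g⁻¹ ∈ A) →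
      ∀ x ∈ A, g * x * g⁻¹ ∈ A := by
    rintro g hg _ ⟨w, rfl⟩
    have : (MulAut.conj g).toMonoidHom.comp (loopHom N s k) =
        FreeGroup.lift fun d : {d : ℕ // k + d < N} => (g * loop s k d * g⁻¹)⁻¹ := by
      ext d
      simp [loopHom, mul_assoc]
    have h1 := DFunLike.congr_fun this w
    simp only [MonoidHom.comp_apply, MulEquiv.toMonoidHom_eq_coe, MonoidHom.coe_coe,
      MulAut.conj_apply] at h1
    rw [h1]
    refine FreeGroup.range_lift_le ?_ ⟨w, rfl⟩
    rintro _ ⟨d, rfl⟩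
    exact A.inv_mem (hg d d.2)
  refine Subgroup.mem_normalizer_iff.2 fun x => ⟨conj _ (fun d hd => (key d hd).1) x, fun hx => ?_⟩
  have := conj (s i)⁻¹ (fun d hd => by simpa using (key d hd).2) _ hx
  simpa [mul_assoc] using this

theorem exists_eq_transport_mul (hs : IsBraidFamily N s) {k : ℕ} (hk : k ≤ N) {g : G}
    (hg : g ∈ tail N s k) :
    ∃ d, k + d ≤ N ∧ ∃ x ∈ (loopHom N s k).range, ∃ h ∈ tail N s (k + 1),
      g = transport s k d * x * h := by
  have step : ∀ d x y h, k + d ≤ N → x ∈ (loopHom N s k).range → y ∈ tail N s (k + 1) →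
      h ∈ tail N s (k + 1) → ∃ d', k + d' ≤ N ∧ ∃ x' ∈ (loopHom N s k).range,
        ∃ h' ∈ tail N s (k + 1),
          transport s k d * y * (x * h) = transport s k d' * x' * h' := by
    intro d x y h hd hx hy hh
    refine ⟨d, hd, y * x * y⁻¹, (Subgroup.mem_normalizer_iff.1 (hs.tail_le_normalizer k hy) x).1 hx,
      y * h, mul_mem hy hh, by group⟩
  induction hg using Subgroup.closure_induction_left with
  | one => exact ⟨0, hk, 1, one_mem _, 1, one_mem _, by simp [transport]⟩
  | mul_left _ hi g _ ih =>
    obtain ⟨i, ⟨hki, hi⟩, rfl⟩ := hi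
    obtain ⟨d, hd, x, hx, h, hh, rfl⟩ := ih
    rcases lt_or_ge (k + d) i with h1 | h1
    · have e := (hs.commute_transport h1 hi).eq
      have := step d x (s i) h hd hx (mem_tail (by omega) hi) hh
      rw [← e] at this
      simpa only [mul_assoc] using this
    rcases lt_or_ge (i + 1) (k + d) with h2 | h2
    · have e := hs.mul_transport hki h2 hd
      have := step d x (s (i + 1)) h hd hx (mem_tail (by omega) (by omega)) hh
      rw [← e] at this
      simpa only [mul_assoc] using this
    obtain rfl | h3 : i = k + d ∨ k + d = i + 1 := by omega
    · refine ⟨d + 1, by omega, loop s k d * x, mul_mem (loop_mem_range hi) hx, h, hh, ?_⟩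
      simp [transport, loop, pow_two, mul_assoc]
    · obtain ⟨e, rfl⟩ : ∃ e, d = e + 1 := ⟨i - k, by omega⟩
      obtain rfl : i = k + e := by omega
      exact ⟨e, by omega, x, hx, h, hh, by simp [transport, mul_assoc]⟩
  | inv_mul_cancel _ hi g _ ih =>
    obtain ⟨i, ⟨hki, hi⟩, rfl⟩ := hi
    obtain ⟨d, hd, x, hx, h, hh, rfl⟩ := ih
    rcases lt_or_ge (k + d) i with h1 | h1
    · have e := (hs.commute_transport h1 hi).inv_left.eq
      have := step d x (s i)⁻¹ h hd hx (inv_mem (mem_tail (by omega) hi)) hh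
      rw [← e] at this
      simpa only [mul_assoc] using this
    rcases lt_or_ge (i + 1) (k + d) with h2 | h2
    · have e := hs.mul_transport hki h2 hd
      have e' : (s i)⁻¹ * transport s k d = transport s k d * (s (i + 1))⁻¹ := by
        rw [inv_mul_eq_iff_eq_mul, ← mul_assoc, e, mul_inv_cancel_right]
      have := step d x (s (i + 1))⁻¹ h hd hx (inv_mem (mem_tail (by omega) (by omega))) hh
      rw [← e'] at this
      simpa only [mul_assoc] using this
    obtain rfl | h3 : i = k + d ∨ k + d = i + 1 := by omega
    · exact ⟨d + 1, by omega, x, hx, h, hh, by simp [transport, mul_assoc]⟩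
    · obtain ⟨e, rfl⟩ : ∃ e, d = e + 1 := ⟨i - k, by omega⟩
      obtain rfl : i = k + e := by omega
      refine ⟨e, by omega, (loop s k e)⁻¹ * x, mul_mem (inv_mem (loop_mem_range hi)) hx, h, hh, ?_⟩
      simp [transport, loop, pow_two, mul_assoc]

end IsBraidFamily

/-! ### Faithfulness of the Artin action -/

/-- The endomorphism of the free group killing the generator `x_k`. -/
def killGen (k : ℕ) : FreeGroup ℕ →* FreeGroup ℕ :=
  FreeGroup.lift fun j => if j = k then 1 else FreeGroup.of j

theorem killGen_of_self (k : ℕ) : killGen k (FreeGroup.of k) = 1 := by simp [killGen]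

theorem killGen_of_of_ne {j k : ℕ} (h : j ≠ k) :
    killGen k (FreeGroup.of j) = FreeGroup.of j := by simp [killGen, h]

/-- An involution of `FreeGroup ℕ × Bool` moving only `(1, false)` and `(1, true)`. -/
noncomputable def flipOne : Equiv.Perm (FreeGroup ℕ × Bool) := Equiv.swap (1, false) (1, true)

/-- An action of the free group in which `x_k` flips the fibre over `1`, and the other generators
act by translations of the base. -/
noncomputable def flipAction (k : ℕ) : FreeGroup ℕ →* Equiv.Perm (FreeGroup ℕ × Bool) :=
  FreeGroup.lift fun j =>
    if j = k then flipOne else (Equiv.mulLeft (FreeGroup.of j)).prodCongr (Equiv.refl Bool)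

theorem flipOne_apply_fst (p : FreeGroup ℕ × Bool) : (flipOne p).1 = p.1 := by
  rw [flipOne, Equiv.swap_apply_def]
  split_ifs with h1 h2 <;> simp [*]

theorem flipAction_apply_fst (k : ℕ) (g : FreeGroup ℕ) (p : FreeGroup ℕ × Bool) :
    (flipAction k g p).1 = killGen k g * p.1 := by
  have gen (j : ℕ) (p : FreeGroup ℕ × Bool) : (flipAction k (FreeGroup.of j) p).1 =
      killGen k (FreeGroup.of j) * p.1 := by
    by_cases h : j = k
    · simp [flipAction, killGen, h, flipOne_apply_fst]
    · simp [flipAction, killGen, h]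
  induction g using FreeGroup.induction_on generalizing p with
  | C1 => simp
  | of j => exact gen j p
  | inv_of j _ =>
    have := gen j ((flipAction k (FreeGroup.of j))⁻¹ p)
    rw [← Equiv.Perm.mul_apply, mul_inv_cancel, Equiv.Perm.one_apply] at this
    rw [map_inv, map_inv, this, inv_mul_cancel_left]
  | mul x y hx hy => rw [map_mul, Equiv.Perm.mul_apply, hx, hy, map_mul, mul_assoc]

theorem killGen_eq_one_of_commute {k : ℕ} {g : FreeGroup ℕ} (h : Commute g (FreeGroup.of k)) :
    killGen k g = 1 := by
  by_contra hne
  have e : flipAction k (FreeGroup.of k) = flipOne := by simp [flipAction]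
  have h1 := DFunLike.congr_fun (congrArg (flipAction k) h.eq) (1, false)
  simp only [map_mul, Equiv.Perm.mul_apply, e] at h1
  have h2 : (flipAction k g (1, false)).1 ≠ 1 := by rwa [flipAction_apply_fst, mul_one]
  have h3 : flipOne (flipAction k g (1, false)) = flipAction k g (1, false) :=
    Equiv.swap_apply_of_ne_of_ne (fun h => h2 (by rw [h])) (fun h => h2 (by rw [h]))
  rw [h3, EmbeddingLike.apply_eq_iff_eq] at h1
  simp [flipOne] at h1

theorem killGen_artinAut_killGen (i : ℕ) (u : FreeGroup ℕ) :
    killGen i (artinAut i (killGen (i + 1) u)) = killGen i (artinAut i u) := by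
  suffices h : ((killGen i).comp (artinAut i).toMonoidHom).comp (killGen (i + 1)) =
      (killGen i).comp (artinAut i).toMonoidHom from DFunLike.congr_fun h u
  ext j
  rcases eq_or_ne j (i + 1) with rfl | h
  · simp [killGen_of_self, artinAut_of_succ]
  · simp [killGen_of_of_ne h]

theorem killGen_artinAut_artinAut (i : ℕ) (u : FreeGroup ℕ) :
    killGen i (artinAut i (artinAut i u)) = killGen i u := by
  suffices h : ((killGen i).comp (artinAut i).toMonoidHom).comp (artinAut i).toMonoidHom =
      killGen i from DFunLike.congr_fun h u
  ext j
  rcases eq_or_ne j i with rfl | h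
  · simp [killGen_of_self, artinAut_of_succ, artinAut_of_self]
  rcases eq_or_ne j (i + 1) with rfl | h'
  · simp [killGen_of_self, artinAut_of_succ, artinAut_of_self]
  · simp [artinAut_of_of_ne h h']

namespace IsBraidFamily

variable {G : Type*} [Group G] {N : ℕ} {s : ℕ → G} {ρ : G →* MulAut (FreeGroup ℕ)}

theorem apply_of_eq_of_mem_tail (hρ : ∀ i < N, ρ (s i) = artinAut i) {k : ℕ} {g : G}
    (hg : g ∈ tail N s (k + 1)) : ρ g (FreeGroup.of k) = FreeGroup.of k := by
  have : tail N s (k + 1) ≤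
      (MulAction.stabilizer (MulAut (FreeGroup ℕ)) (FreeGroup.of k)).comap ρ := by
    rw [tail, Subgroup.closure_le]
    rintro _ ⟨i, ⟨hk, hi⟩, rfl⟩
    change ρ (s i) (FreeGroup.of k) = FreeGroup.of k
    rw [hρ i hi, artinAut_of_of_ne (by omega) (by omega)]
  exact this hg

theorem transport_apply_of (hρ : ∀ i < N, ρ (s i) = artinAut i) {k d : ℕ} (hd : k + d ≤ N) :
    ρ (transport s k d) (FreeGroup.of k) = FreeGroup.of (k + d) := by
  induction d with
  | zero => simp [transport]
  | succ d ih =>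
    rw [transport, map_mul, MulAut.mul_apply, ih (by omega), map_inv, hρ _ (by omega),
      artinAut_inv_of, if_pos rfl, add_assoc]

theorem transport_apply_of_of_lt (hρ : ∀ i < N, ρ (s i) = artinAut i) {k d j : ℕ}
    (hd : k + d ≤ N) (hj : k + d < j) :
    ρ (transport s k d) (FreeGroup.of j) = FreeGroup.of j := by
  induction d with
  | zero => simp [transport]
  | succ d ih =>
    rw [transport, map_mul, MulAut.mul_apply, ih (by omega) (by omega), map_inv,
      hρ _ (by omega), artinAut_inv_of, if_neg (by omega), if_neg (by omega)]

theorem loop_apply_of (hρ : ∀ i < N, ρ (s i) = artinAut i) {k d : ℕ} (hd : k + d < N) :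
    ρ (loop s k d) (FreeGroup.of k) = FreeGroup.of k * FreeGroup.of (k + d + 1) * FreeGroup.of k *
      (FreeGroup.of k * FreeGroup.of (k + d + 1))⁻¹ := by
  have h1 : (ρ (transport s k d))⁻¹ (FreeGroup.of (k + d)) = FreeGroup.of k := by
    rw [← transport_apply_of hρ hd.le, MulAut.inv_apply_self]
  have h2 : (ρ (transport s k d))⁻¹ (FreeGroup.of (k + d + 1)) = FreeGroup.of (k + d + 1) := by
    conv_lhs => rw [← transport_apply_of_of_lt hρ hd.le (lt_add_one (k + d))]
    rw [MulAut.inv_apply_self]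
  simp only [loop, map_mul, map_inv, MulAut.mul_apply, transport_apply_of hρ hd.le,
    hρ _ hd, pow_two, artinAut_of_self, artinAut_of_succ, h1, h2]
  group

theorem exists_killGen_transport_inv (hρ : ∀ i < N, ρ (s i) = artinAut i) {k d : ℕ}
    (hd : k + d ≤ N) : ∃ τ : FreeGroup ℕ →* FreeGroup ℕ,
      ∀ u, killGen k ((ρ (transport s k d))⁻¹ u) = τ (killGen (k + d) u) := by
  induction d with
  | zero => exact ⟨MonoidHom.id _, fun u => by simp [transport]⟩
  | succ d ih =>
    obtain ⟨τ, hτ⟩ := ih (by omega)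
    refine ⟨τ.comp ((killGen (k + d)).comp (artinAut (k + d)).toMonoidHom), fun u => ?_⟩
    simp only [transport, map_mul, map_inv, mul_inv_rev, inv_inv, MulAut.mul_apply, hτ,
      hρ (k + d) (by omega)]
    exact congrArg τ (killGen_artinAut_killGen _ u).symm

theorem killGen_loop_apply (hρ : ∀ i < N, ρ (s i) = artinAut i) {k d : ℕ} (hd : k + d < N)
    (u : FreeGroup ℕ) : killGen k (ρ (loop s k d) u) = killGen k u := by
  obtain ⟨τ, hτ⟩ := exists_killGen_transport_inv hρ hd.le
  rw [loop, map_mul, map_mul, map_inv, MulAut.mul_apply, MulAut.mul_apply, hτ, map_pow, hρ _ hd,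
    pow_two, MulAut.mul_apply, killGen_artinAut_artinAut, ← hτ, MulAut.inv_apply_self]

theorem killGen_loopHom_apply (hρ : ∀ i < N, ρ (s i) = artinAut i) {k : ℕ}
    (w : FreeGroup {d : ℕ // k + d < N}) (u : FreeGroup ℕ) :
    killGen k (ρ (loopHom N s k w) u) = killGen k u := by
  induction w using FreeGroup.induction_on generalizing u with
  | C1 => simp
  | of d =>
    rw [← killGen_loop_apply hρ d.2, loopHom, FreeGroup.lift_apply_of, map_inv,
      MulAut.apply_inv_self]
  | inv_of d _ =>
    rw [loopHom, map_inv, FreeGroup.lift_apply_of, inv_inv, killGen_loop_apply hρ d.2]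
  | mul x y hx hy => rw [map_mul, map_mul, MulAut.mul_apply, hx, hy]

theorem exists_loopHom_apply_of (hρ : ∀ i < N, ρ (s i) = artinAut i) {k : ℕ}
    (w : FreeGroup {d : ℕ // k + d < N}) :
    ∃ θ, ρ (loopHom N s k w) (FreeGroup.of k) = θ * FreeGroup.of k * θ⁻¹ ∧
      killGen k θ = (FreeGroup.map (fun d : {d : ℕ // k + d < N} => k + d + 1) w)⁻¹ := by
  induction w using FreeGroup.induction_on with
  | C1 => exact ⟨1, by simp, by simp⟩
  | of d =>
    refine ⟨(ρ (loop s k d))⁻¹ (FreeGroup.of k * FreeGroup.of (k + d + 1))⁻¹, ?_, ?_⟩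
    · rw [loopHom, FreeGroup.lift_apply_of, map_inv, ← (ρ (loop s k d)).injective.eq_iff]
      simp only [map_mul, map_inv, MulAut.apply_inv_self, loop_apply_of hρ d.2]
      group
    · rw [← killGen_loop_apply hρ d.2, MulAut.apply_inv_self, map_inv, map_mul, killGen_of_self,
        killGen_of_of_ne (by omega), one_mul, FreeGroup.map.of]
  | inv_of d _ =>
    refine ⟨FreeGroup.of k * FreeGroup.of (k + d + 1), ?_, ?_⟩
    · rw [loopHom, map_inv, FreeGroup.lift_apply_of, inv_inv, loop_apply_of hρ d.2]
    · rw [map_mul, killGen_of_self, killGen_of_of_ne (by omega), one_mul, map_inv, inv_inv,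
        FreeGroup.map.of]
  | mul x y hx hy =>
    obtain ⟨θ, h1, h2⟩ := hx
    obtain ⟨θ', h1', h2'⟩ := hy
    refine ⟨ρ (loopHom N s k x) θ' * θ, ?_, ?_⟩
    · rw [map_mul, map_mul, MulAut.mul_apply, h1', map_mul, map_mul, map_inv, h1]
      group
    · rw [map_mul, killGen_loopHom_apply hρ, h2, h2', map_mul, mul_inv_rev]

theorem mem_tail_succ (hs : IsBraidFamily N s) (hρ : ∀ i < N, ρ (s i) = artinAut i) {k : ℕ}
    (hk : k ≤ N) {g : G} (hg : g ∈ tail N s k) (h : ρ g (FreeGroup.of k) = FreeGroup.of k) :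
    g ∈ tail N s (k + 1) := by
  obtain ⟨d, hd, _, ⟨w, rfl⟩, y, hy, rfl⟩ := hs.exists_eq_transport_mul hk hg
  obtain ⟨θ, h1, h2⟩ := exists_loopHom_apply_of hρ w
  rw [map_mul, map_mul, MulAut.mul_apply, apply_of_eq_of_mem_tail hρ hy, MulAut.mul_apply, h1,
    map_mul, map_mul, map_inv, transport_apply_of hρ hd] at h
  obtain rfl : d = 0 := by
    by_contra hne
    have h3 := congrArg (killGen k) h
    rw [map_mul, map_mul, map_inv, killGen_of_self, killGen_of_of_ne (by omega),
      conj_eq_one_iff] at h3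
    exact FreeGroup.of_ne_one _ h3
  simp only [transport, map_one, MulAut.one_apply, add_zero] at h
  rw [killGen_eq_one_of_commute (mul_inv_eq_iff_eq_mul.1 h), eq_comm, inv_eq_one,
    map_eq_one_iff _ (FreeGroup.map_injective fun a b hab => Subtype.ext (by grind))] at h2
  simpa [h2, transport] using hy

theorem eq_one_of_apply_of_eq (hs : IsBraidFamily N s) (hρ : ∀ i < N, ρ (s i) = artinAut i)
    {g : G} (hg : g ∈ tail N s 0) (h : ∀ j, ρ g (FreeGroup.of j) = FreeGroup.of j) : g = 1 := by
  have key : ∀ k ≤ N, g ∈ tail N s k := by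
    intro k
    induction k with
    | zero => exact fun _ => hg
    | succ k ih => exact fun hk => hs.mem_tail_succ hρ (by omega) (ih (by omega)) (h k)
  have h0 := key N le_rfl
  have : {i | N ≤ i ∧ i < N} = ∅ := by ext i; simp
  rwa [tail, this, Set.image_empty, Subgroup.closure_empty, Subgroup.mem_bot] at h0

end IsBraidFamily

/-! ### The order of the braid group -/

namespace BraidGroup

/-- The generators of the braid group, extended by `1` to a sequence. -/
def gen (n i : ℕ) : BraidGroup n := if h : i < n - 1 then σG ⟨i, h⟩ else 1

theorem gen_of_lt {n i : ℕ} (h : i < n - 1) : gen n i = σG ⟨i, h⟩ := dif_pos h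

theorem isBraidFamily_gen (n : ℕ) : IsBraidFamily (n - 1) (gen n) where
  braid i h := by
    rw [gen_of_lt h, gen_of_lt (by omega)]
    refine mul_inv_eq_one.1 ?_
    exact PresentedGroup.one_of_mem (rels := braidRelsGroup n)
      (Or.inl ⟨⟨i, by omega⟩, ⟨i + 1, h⟩, rfl, rfl⟩)
  comm i j h h' := by
    rw [gen_of_lt h', gen_of_lt (by omega)]
    refine mul_inv_eq_one.1 ?_
    exact PresentedGroup.one_of_mem (rels := braidRelsGroup n)
      (Or.inr ⟨⟨i, by omega⟩, ⟨j, h'⟩, h, rfl⟩)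

theorem mem_tail_gen {n : ℕ} (g : BraidGroup n) : g ∈ IsBraidFamily.tail (n - 1) (gen n) 0 := by
  have h : (⊤ : Subgroup (BraidGroup n)) ≤ IsBraidFamily.tail (n - 1) (gen n) 0 := by
    have : Subgroup.closure (Set.range (σG : Fin (n - 1) → BraidGroup n)) = ⊤ :=
      PresentedGroup.closure_range_of _
    rw [← this, Subgroup.closure_le]
    rintro _ ⟨i, rfl⟩
    have := IsBraidFamily.mem_tail (s := gen n) (Nat.zero_le i) i.2
    rwa [gen_of_lt i.2] at this
  exact h trivial

theorem artinAut_braid (i : ℕ) : artinAut i * artinAut (i + 1) * artinAut i =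
    artinAut (i + 1) * artinAut i * artinAut (i + 1) := by
  refine MulEquiv.toMonoidHom_injective (FreeGroup.ext_hom _ _ fun j => ?_)
  change artinAut i (artinAut (i + 1) (artinAut i (FreeGroup.of j))) =
    artinAut (i + 1) (artinAut i (artinAut (i + 1) (FreeGroup.of j)))
  rcases eq_or_ne j i with rfl | h1
  · simp (disch := omega) [artinAut_of_self, artinAut_of_succ, artinAut_of_of_ne, mul_assoc]
  rcases eq_or_ne j (i + 1) with rfl | h2
  · simp (disch := omega) [artinAut_of_self, artinAut_of_succ, artinAut_of_of_ne]
  rcases eq_or_ne j (i + 1 + 1) with rfl | h3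
  · simp (disch := omega) [artinAut_of_succ, artinAut_of_of_ne]
  · simp (disch := omega) [artinAut_of_of_ne]

theorem artinAut_comm {i j : ℕ} (h : i + 2 ≤ j) :
    artinAut i * artinAut j = artinAut j * artinAut i := by
  refine MulEquiv.toMonoidHom_injective (FreeGroup.ext_hom _ _ fun k => ?_)
  change artinAut i (artinAut j (FreeGroup.of k)) = artinAut j (artinAut i (FreeGroup.of k))
  rcases eq_or_ne k i with rfl | h1
  · simp (disch := omega) [artinAut_of_self, artinAut_of_of_ne]
  rcases eq_or_ne k (i + 1) with rfl | h2
  · simp (disch := omega) [artinAut_of_succ, artinAut_of_of_ne]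
  rcases eq_or_ne k j with rfl | h3
  · simp (disch := omega) [artinAut_of_self, artinAut_of_of_ne]
  rcases eq_or_ne k (j + 1) with rfl | h4
  · simp (disch := omega) [artinAut_of_succ, artinAut_of_of_ne]
  · simp (disch := omega) [artinAut_of_of_ne]

/-- The Artin action of the braid group on the free group. -/
def artinAction (n : ℕ) : BraidGroup n →* MulAut (FreeGroup ℕ) :=
  PresentedGroup.toGroup (rels := braidRelsGroup n) (f := fun i : Fin (n - 1) => artinAut i) (by
    rintro _ (⟨i, j, h, rfl⟩ | ⟨i, j, h, rfl⟩)
    · simp only [map_mul, map_inv, FreeGroup.lift_apply_of, mul_inv_eq_one, ← h]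
      exact artinAut_braid i
    · simp only [map_mul, map_inv, FreeGroup.lift_apply_of, mul_inv_eq_one]
      exact artinAut_comm h)

theorem artinAction_gen {n i : ℕ} (h : i < n - 1) : artinAction n (gen n i) = artinAut i := by
  rw [gen_of_lt h]
  exact PresentedGroup.toGroup.of _

theorem artinAction_injective (n : ℕ) : Function.Injective (artinAction n) := by
  refine (injective_iff_map_eq_one (artinAction n)).2 fun g hg => ?_
  exact (isBraidFamily_gen n).eq_one_of_apply_of_eq (fun i => artinAction_gen) (mem_tail_gen g)
    fun j => by rw [hg, MulAut.one_apply]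

theorem artinAction_mem_planarAut {n : ℕ} (g : BraidGroup n) : artinAction n g ∈ planarAut := by
  have : IsBraidFamily.tail (n - 1) (gen n) 0 ≤ planarAut.comap (artinAction n) := by
    rw [IsBraidFamily.tail, Subgroup.closure_le]
    rintro _ ⟨i, ⟨-, hi⟩, rfl⟩
    change artinAction n (gen n i) ∈ planarAut
    rw [artinAction_gen hi]
    exact artinAut_mem_planarAut i
  exact this (mem_tail_gen g)

/-- The codes of the images of the free generators under a braid. -/
noncomputable def orderCode (n : ℕ) (g : BraidGroup n) : Lex (ℕ → List (ℤ ×ₗ ℤ)) :=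
  toLex fun j => planarCode (artinAction n g (FreeGroup.of j))

theorem orderCode_injective (n : ℕ) : Function.Injective (orderCode n) := by
  intro g h hgh
  refine artinAction_injective n (MulEquiv.toMonoidHom_injective
    (FreeGroup.ext_hom _ _ fun j => ?_))
  exact planarCode_injective (congrFun hgh j)

theorem orderCode_mul_lt {n : ℕ} (g : BraidGroup n) {h h' : BraidGroup n}
    (hlt : orderCode n h < orderCode n h') : orderCode n (g * h) < orderCode n (g * h') := by
  obtain ⟨j, hj, hlt⟩ := hlt
  refine ⟨j, fun i hi => ?_, ?_⟩
  · have := planarCode_injective (hj i hi)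
    simp [orderCode, this]
  · simpa [orderCode] using (artinAction_mem_planarAut g _ _).2 hlt

end BraidGroup

/-- The braid group `B_n` is left-orderable: there is a strict linear order on `B_n`
invariant under left multiplication. -/
theorem braidGroup_leftOrderable (n : ℕ) (hn : 1 ≤ n) :
    ∃ lt : BraidGroup n → BraidGroup n → Prop,
      IsStrictTotalOrder (BraidGroup n) lt ∧
      ∀ g h h' : BraidGroup n, lt h h' → lt (g * h) (g * h') := by
  let := LinearOrder.lift' (BraidGroup.orderCode n) (BraidGroup.orderCode_injective n)
  exact ⟨(· < ·), inferInstance, fun g _ _ h => BraidGroup.orderCode_mul_lt g h⟩
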